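/- arXiv:0911.2205 — 2 statements merged into one kernel-verified Lean document; each statement's English description precedes it below -/
import Mathlib

section
/- Let Q, P, ω : ℝ → M₃(ℝ) and r, p, v : ℝ → ℝ³ with Q, P, r, p differentiable and ω, v continuous, satisfying the SE(3) geodesic equations Q′(t) = ω(t)·Q(t), r′(t) = ω(t)·r(t) + v(t), P′(t) = −ω(t)ᵀ·P(t), and p′(t) = ω(t)ᵀ·p(t) for all t. Then t ↦ trace(P(t)ᵀ·Q(t)·w) is constant in t; in particular, if trace(P(1)ᵀ·Q(1)·w) = 0 then trace(P(t)ᵀ·Q(t)·w) = 0 for all t. -/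
open Matrix

attribute [local instance] Matrix.normedAddCommGroup Matrix.normedSpace

/-- The generator of rotations about the z-axis. -/
noncomputable def wz : Matrix (Fin 3) (Fin 3) ℝ := !![0, 1, 0; -1, 0, 0; 0, 0, 0]

theorem hasDerivAt_matrix_apply {m n : Type*} [Fintype m] [Fintype n]
    {A : ℝ → Matrix m n ℝ} {A' : Matrix m n ℝ} {t : ℝ} (hA : HasDerivAt A A' t) (i : m) (j : n) :
    HasDerivAt (fun s => A s i j) (A' i j) t :=
  hasDerivAt_pi.1 (hasDerivAt_pi.1 hA i) j

/-- Solutions of a linear equation `Q' = ωQ` and of its adjoint equation `P' = -ωᵀP` have a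
constant pairing `PᵀQ`. -/
theorem transpose_mul_eq_of_adjoint_flow {n : Type*} [Fintype n] {Q P ω : ℝ → Matrix n n ℝ}
    (hQ : ∀ t : ℝ, HasDerivAt Q (ω t * Q t) t)
    (hP : ∀ t : ℝ, HasDerivAt P (-(ω t)ᵀ * P t) t) (s t : ℝ) :
    (P s)ᵀ * Q s = (P t)ᵀ * Q t := by
  ext i j
  have key : ∀ x : ℝ, HasDerivAt (fun y => ((P y)ᵀ * Q y) i j) 0 x := by
    intro x
    have h := HasDerivAt.fun_sum (u := Finset.univ) fun k _ =>
      (hasDerivAt_matrix_apply (hP x) k i).mul (hasDerivAt_matrix_apply (hQ x) k j)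
    have hz : ∑ k, ((-(ω x)ᵀ * P x) k i * Q x k j + P x k i * (ω x * Q x) k j) = 0 := by
      have hm : (-(ω x)ᵀ * P x)ᵀ * Q x + (P x)ᵀ * (ω x * Q x) = 0 := by
        simp [Matrix.transpose_mul, Matrix.mul_assoc]
      rw [Finset.sum_add_distrib]
      exact congrFun (congrFun hm i) j
    rw [hz] at h
    exact h
  exact is_const_of_deriv_eq_zero (fun x => (key x).differentiableAt) (fun x => (key x).deriv) s t

/-- Conservation of the right SO(2)-action momentum `trace(PᵀQw)` along the SE(3)
geodesic equations `Q' = ωQ`, `r' = ωr + v`, `P' = -ωᵀP`, `p' = ωᵀp`; in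
particular, if the momentum vanishes at `t = 1` then it vanishes for all `t`. -/
theorem se3_momentum_conserved
    (Q P ω : ℝ → Matrix (Fin 3) (Fin 3) ℝ)
    (r p v : ℝ → (Fin 3 → ℝ))
    (hω : Continuous ω) (hv : Continuous v)
    (hQ : ∀ t : ℝ, HasDerivAt Q (ω t * Q t) t)
    (hr : ∀ t : ℝ, HasDerivAt r ((ω t).mulVec (r t) + v t) t)
    (hP : ∀ t : ℝ, HasDerivAt P (-(ω t)ᵀ * P t) t)
    (hp : ∀ t : ℝ, HasDerivAt p ((ω t)ᵀ.mulVec (p t)) t) :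
    (∀ t : ℝ, ((P t)ᵀ * Q t * wz).trace = ((P 0)ᵀ * Q 0 * wz).trace) ∧
    (((P 1)ᵀ * Q 1 * wz).trace = 0 → ∀ t : ℝ, ((P t)ᵀ * Q t * wz).trace = 0) := by
  have h := transpose_mul_eq_of_adjoint_flow hQ hP
  exact ⟨fun t => by rw [h t 0], fun h1 t => by rw [h t 1, h1]⟩
end

section
/- Let n ∈ ℕ and fix an antisymmetric matrix ν ∈ Mₙ(ℝ). Let Q̄, P̄, ξ : ℝ → Mₙ(ℝ) with Q̄ and P̄ differentiable, ξ continuous, and ξ(t) antisymmetric (ξ(t)ᵀ = −ξ(t)) for all t, satisfying Q̄′(t) = ξ(t)·Q̄(t) + Q̄(t)·ν and P̄′(t) = −ξ(t)ᵀ·P̄(t) + P̄(t)·ν. Define M̄(t) := (Q̄(t)·P̄(t)ᵀ − P̄(t)·Q̄(t)ᵀ)/2. Then M̄ is differentiable and M̄′(t) = ξ(t)·M̄(t) − M̄(t)·ξ(t) for all t; in particular the terms involving ν cancel and M̄ obeys the same reduced (Euler–Poincaré) equation as in the unreparameterised problem (ν = 0). -/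
open Matrix

attribute [local instance] Matrix.normedAddCommGroup Matrix.normedSpace

/-- Product rule for matrix-valued curves. -/
theorem hasDerivAt_matrix_mul {l m n : Type*} [Fintype l] [Fintype m] [Fintype n]
    {A : ℝ → Matrix l m ℝ} {B : ℝ → Matrix m n ℝ} {A' : Matrix l m ℝ} {B' : Matrix m n ℝ} {t : ℝ}
    (hA : HasDerivAt A A' t) (hB : HasDerivAt B B' t) :
    HasDerivAt (fun s => A s * B s) (A' * B t + A t * B') t := by
  refine hasDerivAt_pi.2 fun i => hasDerivAt_pi.2 fun j => ?_
  have entry : HasDerivAt (fun s => ∑ k, A s i k * B s k j)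
      (∑ k, (A' i k * B t k j + A t i k * B' k j)) t :=
    HasDerivAt.fun_sum fun k _ =>
      (hasDerivAt_pi.1 (hasDerivAt_pi.1 hA i) k).mul (hasDerivAt_pi.1 (hasDerivAt_pi.1 hB k) j)
  simpa only [Matrix.add_apply, Matrix.mul_apply, Finset.sum_add_distrib] using entry

/-- Transposition commutes with differentiation of matrix-valued curves. -/
theorem hasDerivAt_matrix_transpose {m n : Type*} [Fintype m] [Fintype n]
    {A : ℝ → Matrix m n ℝ} {A' : Matrix m n ℝ} {t : ℝ} (hA : HasDerivAt A A' t) :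
    HasDerivAt (fun s => (A s)ᵀ) A'ᵀ t :=
  hasDerivAt_pi.2 fun i => hasDerivAt_pi.2 fun j => hasDerivAt_pi.1 (hasDerivAt_pi.1 hA j) i

/-- The reduced (Euler–Poincaré) equation for the reparameterised geodesic
problem, realised for matrix groups: with `Q̄' = ξQ̄ + Q̄ν`, `P̄' = -ξᵀP̄ + P̄ν`,
`ν` and `ξ(t)` antisymmetric, the left-action momentum
`M̄ = (Q̄P̄ᵀ - P̄Q̄ᵀ)/2` is differentiable and satisfies `M̄' = ξM̄ - M̄ξ`;
the `ν` terms cancel. -/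
theorem matrix_reparam_reduced_equation
    (n : ℕ) (ν : Matrix (Fin n) (Fin n) ℝ) (hνanti : νᵀ = -ν)
    (Qb Pb ξ : ℝ → Matrix (Fin n) (Fin n) ℝ)
    (hξ : Continuous ξ)
    (hξanti : ∀ t : ℝ, (ξ t)ᵀ = -ξ t)
    (hQb : ∀ t : ℝ, HasDerivAt Qb (ξ t * Qb t + Qb t * ν) t)
    (hPb : ∀ t : ℝ, HasDerivAt Pb (-(ξ t)ᵀ * Pb t + Pb t * ν) t)
    (M : ℝ → Matrix (Fin n) (Fin n) ℝ)
    (hM : M = fun t => (2⁻¹ : ℝ) • (Qb t * (Pb t)ᵀ - Pb t * (Qb t)ᵀ)) :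
    ∀ t : ℝ, HasDerivAt M (ξ t * M t - M t * ξ t) t := by
  intro t
  subst hM
  have hQP := hasDerivAt_matrix_mul (hQb t) (hasDerivAt_matrix_transpose (hPb t))
  have hPQ := hasDerivAt_matrix_mul (hPb t) (hasDerivAt_matrix_transpose (hQb t))
  refine ((hQP.sub hPQ).const_smul (2⁻¹ : ℝ)).congr_deriv ?_
  simp only [transpose_add, transpose_mul, hνanti, hξanti, neg_neg, Matrix.mul_smul,
    Matrix.smul_mul, ← smul_sub]
  congr 1
  noncomm_ring
end
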